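/- For every positive integer N, for Lebesgue almost every x ∈ [0,1), the denominators B_n of the N-continued fraction convergents of x satisfy lim_{n→∞} (ln B_n)/n = Λ_N + ln N, where Λ_N = Θ(1/N)/ln(1+1/N) and Θ(x) = ∫_0^x ln(1+t)/t dt. -/

import Mathlib

open MeasureTheory Filter Set

/-- The generalized Gauss transformation `T_N(x) = {N/x}` (and `T_N(0) = 0`). -/
noncomputable def gaussT (N : ℕ) (x : ℝ) : ℝ :=
  if x = 0 then 0 else Int.fract ((N : ℝ) / x)

/-- The denominators of the `N`-continued fraction convergents of `x`:
`gaussB N x (n+1)` stands for `B_n`, with `B_{-1} = 0`, `B_0 = 1` and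
`B_n = a_n B_{n-1} + N B_{n-2}`, where `a_k = ⌊N / T_N^[k-1] x⌋`. -/
noncomputable def gaussB (N : ℕ) (x : ℝ) : ℕ → ℤ
  | 0 => 0
  | 1 => 1
  | (n + 2) => ⌊(N : ℝ) / (gaussT N)^[n] x⌋ * gaussB N x (n + 1) + N * gaussB N x n

/-- The dilogarithm-type function `Θ(x) = ∫_0^x log(1+t)/t dt`. -/
noncomputable def dilogTheta (x : ℝ) : ℝ :=
  ∫ t in (0:ℝ)..x, Real.log (1 + t) / t

/-- The constant `Λ_N = Θ(1/N) / log(1 + 1/N)`. -/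
noncomputable def gaussLambda (N : ℕ) : ℝ :=
  dilogTheta (1 / (N : ℝ)) / Real.log (1 + 1 / (N : ℝ))

/-- The running maximum `max (S_1 f x) … (S_{n+1} f x)` of the Birkhoff sums of `f` along `T`,
defined through its recursion in `n`. -/
noncomputable def birkhoffMax {α : Type*} (T : α → α) (f : α → ℝ) : ℕ → α → ℝ
  | 0 => f
  | n + 1 => fun x => f x + max 0 (birkhoffMax T f n (T x))

section BirkhoffMax

variable {α : Type*} {T : α → α} {f : α → ℝ}

lemma birkhoffMax_le_succ (n : ℕ) (x : α) :
    birkhoffMax T f n x ≤ birkhoffMax T f (n + 1) x := by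
  induction n generalizing x with
  | zero => simp [birkhoffMax]
  | succ n ih =>
    have := ih (T x)
    simp only [birkhoffMax] at this ⊢
    gcongr

lemma birkhoffMax_monotone (x : α) : Monotone fun n => birkhoffMax T f n x :=
  monotone_nat_of_le_succ fun n => birkhoffMax_le_succ n x

lemma birkhoffSum_succ_le_birkhoffMax (n : ℕ) (x : α) :
    birkhoffSum T f (n + 1) x ≤ birkhoffMax T f n x := by
  induction n generalizing x with
  | zero => simp [birkhoffMax]
  | succ n ih =>
    rw [birkhoffSum_succ']
    simp only [birkhoffMax]
    gcongr
    exact (ih _).trans (le_max_right _ _)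

lemma bddAbove_range_birkhoffMax_apply_iff (x : α) :
    BddAbove (range fun n => birkhoffMax T f n (T x)) ↔
      BddAbove (range fun n => birkhoffMax T f n x) := by
  constructor
  · rintro ⟨C, hC⟩
    refine ⟨f x + max 0 C, ?_⟩
    rintro _ ⟨n, rfl⟩
    refine (birkhoffMax_le_succ n x).trans ?_
    simp only [birkhoffMax]
    gcongr
    exact hC ⟨n, rfl⟩
  · rintro ⟨C, hC⟩
    refine ⟨C - f x, ?_⟩
    rintro _ ⟨n, rfl⟩
    have h : birkhoffMax T f (n + 1) x ≤ C := hC ⟨n + 1, rfl⟩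
    simp only [birkhoffMax] at h
    linarith [le_max_right 0 (birkhoffMax T f n (T x))]

variable [MeasurableSpace α] {μ : Measure α}

lemma measurable_birkhoffMax (hT : Measurable T) (hf : Measurable f) (n : ℕ) :
    Measurable (birkhoffMax T f n) := by
  induction n with
  | zero => exact hf
  | succ n ih => exact hf.add (measurable_const.max (ih.comp hT))

lemma integrable_birkhoffMax (hT : MeasurePreserving T μ μ) (hf : Integrable f μ) (n : ℕ) :
    Integrable (birkhoffMax T f n) μ := by
  induction n with
  | zero => exact hf
  | succ n ih =>
    have h : Integrable (fun x => birkhoffMax T f n (T x)) μ := hT.integrable_comp_of_integrable ih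
    refine hf.add (h.pos_part.congr (ae_of_all _ fun x => ?_))
    simp [max_comm]

/-- If the running maxima of the Birkhoff sums are almost everywhere unbounded, then `f` has
nonnegative integral. -/
lemma integral_nonneg_of_ae_not_bddAbove (hT : MeasurePreserving T μ μ) (hf : Integrable f μ)
    (h : ∀ᵐ x ∂μ, ¬ BddAbove (range fun n => birkhoffMax T f n x)) : 0 ≤ ∫ x, f x ∂μ := by
  have hM := integrable_birkhoffMax hT hf
  have hMT : ∀ n, Integrable (fun x => birkhoffMax T f n (T x)) μ :=
    fun n => hT.integrable_comp_of_integrable (hM n)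
  have hlim : Tendsto
      (fun n => ∫ x, (birkhoffMax T f (n + 1) x - birkhoffMax T f n (T x)) ∂μ) atTop
      (nhds (∫ x, f x ∂μ)) := by
    refine tendsto_integral_of_dominated_convergence (fun x => |f x| + |f (T x)|)
      (fun n => ((hM (n + 1)).sub (hMT n)).aestronglyMeasurable)
      (hf.abs.add (hMT 0).abs) (fun n => ae_of_all _ fun x => ?_) ?_
    · have h0 : f (T x) ≤ birkhoffMax T f n (T x) := birkhoffMax_monotone (T x) (Nat.zero_le n)
      simp only [birkhoffMax, Real.norm_eq_abs]
      rcases max_cases 0 (birkhoffMax T f n (T x)) with ⟨h1, h2⟩ | ⟨h1, h2⟩ <;> rw [h1]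
      · refine abs_le.2 ⟨?_, ?_⟩ <;>
        linarith [neg_abs_le (f x), le_abs_self (f x), neg_abs_le (f (T x)), abs_nonneg (f (T x))]
      · simp
    · filter_upwards [h] with x hx
      rw [← bddAbove_range_birkhoffMax_apply_iff] at hx
      have hev :=
        (tendsto_atTop_atTop_of_monotone' (birkhoffMax_monotone (T x)) hx).eventually_ge_atTop 0
      refine tendsto_const_nhds.congr' ?_
      filter_upwards [hev] with n hn
      simp [birkhoffMax, max_eq_right hn]
  refine ge_of_tendsto' hlim fun n => ?_
  rw [integral_sub (hM _) (hMT n)]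
  have hcomp : ∫ x, birkhoffMax T f n (T x) ∂μ = ∫ x, birkhoffMax T f n x ∂μ := by
    have := integral_map (μ := μ) hT.measurable.aemeasurable (f := birkhoffMax T f n)
      (by rw [hT.map_eq]; exact (hM n).aestronglyMeasurable)
    rw [← this, hT.map_eq]
  rw [hcomp, sub_nonneg]
  exact integral_mono (hM n) (hM _) fun x => birkhoffMax_le_succ n x

lemma Ergodic.ae_birkhoffSum_bddAbove (hT : Ergodic T μ) (hfm : Measurable f)
    (hf : Integrable f μ) (hneg : ∫ x, f x ∂μ < 0) :
    ∀ᵐ x ∂μ, ∃ C, ∀ n, birkhoffSum T f n x ≤ C := by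
  set A := {x | BddAbove (range fun n => birkhoffMax T f n x)} with hA
  have hAm : MeasurableSet A :=
    measurableSet_bddAbove_range (measurable_birkhoffMax hT.measurable hfm)
  have hAinv : T ⁻¹' A = A := ext fun x => bddAbove_range_birkhoffMax_apply_iff x
  rcases eventuallyConst_set.1 (hT.aeconst_set hAm hAinv) with h | h
  · filter_upwards [h] with x ⟨C, hC⟩
    refine ⟨max 0 C, fun n => ?_⟩
    cases n with
    | zero => simp
    | succ n =>
      exact (birkhoffSum_succ_le_birkhoffMax n x).trans ((hC ⟨n, rfl⟩).trans (le_max_right _ _))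
  · exact absurd (integral_nonneg_of_ae_not_bddAbove hT.toMeasurePreserving hf h) (not_le.2 hneg)

lemma Ergodic.ae_eventually_birkhoffAverage_lt [IsFiniteMeasure μ] (hT : Ergodic T μ)
    (hfm : Measurable f) (hf : Integrable f μ) {c : ℝ} (hc : ⨍ x, f x ∂μ < c) :
    ∀ᵐ x ∂μ, ∀ᶠ n in atTop, birkhoffAverage ℝ T f n x < c := by
  rcases eq_zero_or_neZero μ with rfl | hμ
  · simp
  obtain ⟨d, hd, hdc⟩ := exists_between hc
  have hneg : ∫ x, (f x - d) ∂μ < 0 := by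
    have hpos : 0 < μ.real univ := by
      simp [Measure.real, ENNReal.toReal_pos_iff, hμ.out, pos_iff_ne_zero]
    rw [integral_sub hf (integrable_const d), integral_const, smul_eq_mul]
    rw [average_eq, smul_eq_mul, inv_mul_lt_iff₀ hpos] at hd
    linarith
  filter_upwards [hT.ae_birkhoffSum_bddAbove (hfm.sub_const d) (hf.sub (integrable_const d)) hneg]
    with x ⟨C, hC⟩
  have hlim : Tendsto (fun n : ℕ => C / n + d) atTop (nhds (0 + d)) :=
    (tendsto_const_div_atTop_nhds_zero_nat C).add_const d
  rw [zero_add] at hlim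
  filter_upwards [hlim.eventually_lt_const hdc, eventually_gt_atTop 0] with n hn hn0
  refine lt_of_le_of_lt ?_ hn
  have hn' : (0 : ℝ) < n := by exact_mod_cast hn0
  have h := hC n
  simp only [birkhoffSum, Finset.sum_sub_distrib, Finset.sum_const, Finset.card_range,
    nsmul_eq_mul] at h
  simp only [birkhoffAverage, birkhoffSum, smul_eq_mul]
  rw [inv_mul_le_iff₀ hn']
  field_simp
  linarith

/-- Birkhoff's pointwise ergodic theorem for an ergodic map. -/
theorem Ergodic.ae_tendsto_birkhoffAverage [IsFiniteMeasure μ] (hT : Ergodic T μ)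
    (hfm : Measurable f) (hf : Integrable f μ) :
    ∀ᵐ x ∂μ, Tendsto (fun n => birkhoffAverage ℝ T f n x) atTop (nhds (⨍ x, f x ∂μ)) := by
  have hup : ∀ᵐ x ∂μ, ∀ k : ℕ, ∀ᶠ n in atTop,
      birkhoffAverage ℝ T f n x < ⨍ x, f x ∂μ + 1 / (k + 1) :=
    ae_all_iff.2 fun k => hT.ae_eventually_birkhoffAverage_lt hfm hf
      (lt_add_of_pos_right _ (by positivity))
  have hlow : ∀ᵐ x ∂μ, ∀ k : ℕ, ∀ᶠ n in atTop,
      birkhoffAverage ℝ T (-f) n x < ⨍ x, (-f) x ∂μ + 1 / (k + 1) :=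
    ae_all_iff.2 fun k => hT.ae_eventually_birkhoffAverage_lt hfm.neg hf.neg
      (lt_add_of_pos_right _ (by positivity))
  filter_upwards [hup, hlow] with x h1 h2
  rw [Metric.tendsto_nhds]
  intro ε hε
  obtain ⟨k, hk⟩ := exists_nat_one_div_lt hε
  filter_upwards [h1 k, h2 k] with n hn1 hn2
  have : ⨍ x, (-f) x ∂μ = -⨍ x, f x ∂μ := by
    simp [average_eq, integral_neg]
  rw [birkhoffAverage_neg, this] at hn2
  simp only [Pi.neg_apply] at hn2
  rw [Real.dist_eq, abs_lt]
  constructor <;> linarith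

end BirkhoffMax

section Digits

variable {N : ℕ} {x : ℝ}

lemma gaussT_of_ne_zero (hx : x ≠ 0) : gaussT N x = Int.fract (N / x) := if_neg hx

lemma measurable_gaussT (N : ℕ) : Measurable (gaussT N) :=
  Measurable.ite (measurableSet_singleton 0) measurable_const
    (measurable_fract.comp (measurable_const.div measurable_id))

lemma irrational_gaussT (hN : 0 < N) (hx : Irrational x) : Irrational (gaussT N x) := by
  rw [gaussT_of_ne_zero hx.ne_zero]
  exact (irrational_natCast_div_iff.2 ⟨hN.ne', hx⟩).sub_intCast _

lemma irrational_iterate_gaussT (hN : 0 < N) (hx : Irrational x) (n : ℕ) :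
    Irrational ((gaussT N)^[n] x) := by
  induction n with
  | zero => exact hx
  | succ n ih => rw [Function.iterate_succ_apply']; exact irrational_gaussT hN ih

lemma gaussT_mem_Ioo (hN : 0 < N) (hx : Irrational x) : gaussT N x ∈ Ioo (0 : ℝ) 1 := by
  have h := (irrational_gaussT hN hx).ne_zero
  rw [gaussT_of_ne_zero hx.ne_zero] at h ⊢
  exact ⟨(Int.fract_nonneg _).lt_of_ne h.symm, Int.fract_lt_one _⟩

lemma iterate_gaussT_mem_Ioo (hN : 0 < N) (hx : Irrational x) (hx01 : x ∈ Ioo (0 : ℝ) 1) (n : ℕ) :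
    (gaussT N)^[n] x ∈ Ioo (0 : ℝ) 1 := by
  cases n with
  | zero => exact hx01
  | succ n =>
    rw [Function.iterate_succ_apply']
    exact gaussT_mem_Ioo hN (irrational_iterate_gaussT hN hx n)

/-- The digit `a_{n+1}` of `x`, as a real number. -/
noncomputable def gaussDigit (N : ℕ) (x : ℝ) (n : ℕ) : ℝ := ⌊(N : ℝ) / (gaussT N)^[n] x⌋

lemma le_gaussDigit (hN : 0 < N) (hx : Irrational x) (hx01 : x ∈ Ioo (0 : ℝ) 1) (n : ℕ) :
    (N : ℝ) ≤ gaussDigit N x n := by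
  obtain ⟨h0, h1⟩ := iterate_gaussT_mem_Ioo hN hx hx01 n
  have : (N : ℤ) ≤ ⌊(N : ℝ) / (gaussT N)^[n] x⌋ := by
    rw [Int.le_floor, Int.cast_natCast]
    exact le_div_self (Nat.cast_nonneg N) h0 h1.le
  rw [gaussDigit]
  exact_mod_cast this

lemma gaussDigit_add_gaussT (hN : 0 < N) (hx : Irrational x) (n : ℕ) :
    gaussDigit N x n + (gaussT N)^[n + 1] x = N / (gaussT N)^[n] x := by
  rw [Function.iterate_succ_apply', gaussT_of_ne_zero (irrational_iterate_gaussT hN hx n).ne_zero]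
  exact Int.floor_add_fract _

lemma gaussB_add_two_cast (n : ℕ) :
    (gaussB N x (n + 2) : ℝ) = gaussDigit N x n * gaussB N x (n + 1) + N * gaussB N x n := by
  simp [gaussB, gaussDigit]

lemma gaussB_bounds (hN : 0 < N) (hx : Irrational x) (hx01 : x ∈ Ioo (0 : ℝ) 1) (n : ℕ) :
    (0 : ℝ) ≤ gaussB N x n ∧ (1 : ℝ) ≤ gaussB N x (n + 1) ∧
      (gaussB N x n : ℝ) ≤ gaussB N x (n + 1) := by
  have hN1 : (1 : ℝ) ≤ N := by exact_mod_cast hN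
  induction n with
  | zero => simp [gaussB]
  | succ n ih =>
    obtain ⟨h0, h1, h2⟩ := ih
    have ha := hN1.trans (le_gaussDigit hN hx hx01 n)
    have h3 : (gaussB N x (n + 1) : ℝ) ≤ gaussB N x (n + 2) := by
      rw [gaussB_add_two_cast]
      nlinarith
    exact ⟨by linarith, h1.trans h3, h3⟩

lemma two_mul_pow_le_gaussB_mul (hN : 0 < N) (hx : Irrational x) (hx01 : x ∈ Ioo (0 : ℝ) 1)
    (n : ℕ) : (2 * N : ℝ) ^ n ≤ gaussB N x (n + 1) * gaussB N x (n + 2) := by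
  have hN1 : (1 : ℝ) ≤ N := by exact_mod_cast hN
  induction n with
  | zero =>
    have := (gaussB_bounds hN hx hx01 1).2.1
    simpa [gaussB] using this
  | succ n ih =>
    obtain ⟨h0, h1, h2⟩ := gaussB_bounds hN hx hx01 (n + 1)
    have ha := le_gaussDigit hN hx hx01 (n + 1)
    rw [pow_succ, gaussB_add_two_cast (n + 1)]
    have h3 : (N : ℝ) * gaussB N x (n + 2) ≤ gaussDigit N x (n + 1) * gaussB N x (n + 2) := by
      gcongr
    have h4 : (2 * N : ℝ) * gaussB N x (n + 1) ≤
        gaussDigit N x (n + 1) * gaussB N x (n + 2) + N * gaussB N x (n + 1) := by nlinarith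
    calc (2 * N : ℝ) ^ n * (2 * N) ≤ gaussB N x (n + 1) * gaussB N x (n + 2) * (2 * N) := by gcongr
      _ = gaussB N x (n + 2) * (2 * N * gaussB N x (n + 1)) := by ring
      _ ≤ _ := by
        gcongr

lemma tendsto_pow_div_gaussB_sq (hN : 0 < N) (hx : Irrational x) (hx01 : x ∈ Ioo (0 : ℝ) 1) :
    Tendsto (fun n => (N : ℝ) ^ n / (gaussB N x (n + 1) : ℝ) ^ 2) atTop (nhds 0) := by
  have hN0 : (0 : ℝ) < N := by exact_mod_cast hN
  rw [← tendsto_add_atTop_iff_nat 1]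
  have hlim : Tendsto (fun n : ℕ => (N : ℝ) * (1 / 2) ^ n) atTop (nhds (N * 0)) :=
    (tendsto_pow_atTop_nhds_zero_of_lt_one (by norm_num) (by norm_num)).const_mul _
  rw [mul_zero] at hlim
  refine squeeze_zero (fun n => by positivity) (fun n => ?_) hlim
  obtain ⟨h0, h1, h2⟩ := gaussB_bounds hN hx hx01 (n + 1)
  have h := two_mul_pow_le_gaussB_mul hN hx hx01 n
  have h3 : (2 * N : ℝ) ^ n ≤ (gaussB N x (n + 1 + 1) : ℝ) ^ 2 := by
    refine h.trans ?_
    rw [sq]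
    gcongr
  calc (N : ℝ) ^ (n + 1) / (gaussB N x (n + 1 + 1) : ℝ) ^ 2
      ≤ (N : ℝ) ^ (n + 1) / (2 * N : ℝ) ^ n := by gcongr
    _ = N * (1 / 2) ^ n := by
      rw [mul_pow, pow_succ, div_pow, one_pow]
      field_simp

/-- The product formula `B_n + T^n x * B_{n-1} = ∏_{k<n} N / T^k x`, in logarithmic form. -/
lemma log_gaussB_add (hN : 0 < N) (hx : Irrational x) (hx01 : x ∈ Ioo (0 : ℝ) 1) (n : ℕ) :
    Real.log (gaussB N x (n + 1) + (gaussT N)^[n] x * gaussB N x n) =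
      birkhoffSum (gaussT N) (fun y => Real.log N - Real.log y) n x := by
  have hN0 : (0 : ℝ) < N := by exact_mod_cast hN
  induction n with
  | zero => simp [gaussB]
  | succ n ih =>
    obtain ⟨h0, h1, -⟩ := gaussB_bounds hN hx hx01 n
    obtain ⟨ht0, -⟩ := iterate_gaussT_mem_Ioo hN hx hx01 n
    have key : (gaussB N x (n + 1 + 1) : ℝ) + (gaussT N)^[n + 1] x * gaussB N x (n + 1) =
        N / (gaussT N)^[n] x * (gaussB N x (n + 1) + (gaussT N)^[n] x * gaussB N x n) := by
      have h := gaussDigit_add_gaussT hN hx n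
      rw [gaussB_add_two_cast, mul_add, ← mul_assoc (_ / _), div_mul_cancel₀ _ ht0.ne', ← h]
      ring
    rw [key, birkhoffSum_succ, ← ih, Real.log_mul (by positivity) (by positivity),
      Real.log_div hN0.ne' ht0.ne']
    ring

lemma abs_log_gaussB_sub_birkhoffSum_le (hN : 0 < N) (hx : Irrational x)
    (hx01 : x ∈ Ioo (0 : ℝ) 1) (n : ℕ) :
    |Real.log (gaussB N x (n + 1)) -
      birkhoffSum (gaussT N) (fun y => Real.log N - Real.log y) n x| ≤ Real.log 2 := by
  obtain ⟨h0, h1, h2⟩ := gaussB_bounds hN hx hx01 n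
  obtain ⟨ht0, ht1⟩ := iterate_gaussT_mem_Ioo hN hx hx01 n
  rw [← log_gaussB_add hN hx hx01]
  have hlow : Real.log (gaussB N x (n + 1)) ≤
      Real.log (gaussB N x (n + 1) + (gaussT N)^[n] x * gaussB N x n) :=
    Real.log_le_log (by linarith) (by nlinarith)
  have hup : Real.log (gaussB N x (n + 1) + (gaussT N)^[n] x * gaussB N x n) ≤
      Real.log 2 + Real.log (gaussB N x (n + 1)) := by
    rw [← Real.log_mul (by norm_num) (by linarith)]
    exact Real.log_le_log (by nlinarith) (by nlinarith)
  have := Real.log_pos one_lt_two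
  rw [abs_le]
  constructor <;> linarith

/-- The inverse branch of `T_N^n` on the rank-`n` cylinder containing `x`. -/
noncomputable def gaussBranch (N : ℕ) (x : ℝ) : ℕ → ℝ → ℝ
  | 0 => id
  | n + 1 => fun t => gaussBranch N x n (N / (gaussDigit N x n + t))

lemma gaussBranch_iterate_gaussT (hN : 0 < N) (hx : Irrational x) (n : ℕ) :
    gaussBranch N x n ((gaussT N)^[n] x) = x := by
  induction n with
  | zero => rfl
  | succ n ih =>
    have hN0 : (N : ℝ) ≠ 0 := by exact_mod_cast hN.ne'
    simp only [gaussBranch]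
    rw [gaussDigit_add_gaussT hN hx, div_div_cancel₀ hN0, ih]

lemma iterate_gaussT_gaussBranch (hN : 0 < N) (hx : Irrational x) (hx01 : x ∈ Ioo (0 : ℝ) 1)
    (n : ℕ) {t : ℝ} (ht : t ∈ Ioo (0 : ℝ) 1) :
    (gaussT N)^[n] (gaussBranch N x n t) = t := by
  induction n generalizing t with
  | zero => rfl
  | succ n ih =>
    have hN0 : (0 : ℝ) < N := by exact_mod_cast hN
    have ha := le_gaussDigit hN hx hx01 n
    have hpos : 0 < gaussDigit N x n + t := by linarith [ht.1]
    have hs : (N : ℝ) / (gaussDigit N x n + t) ∈ Ioo (0 : ℝ) 1 :=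
      ⟨by positivity, by rw [div_lt_one hpos]; linarith [ht.1]⟩
    rw [Function.iterate_succ_apply', gaussBranch, ih hs, gaussT_of_ne_zero hs.1.ne',
      div_div_cancel₀ hN0.ne', gaussDigit, Int.fract_intCast_add]
    exact Int.fract_eq_self.2 ⟨ht.1.le, ht.2⟩

lemma abs_gaussBranch_sub (hN : 0 < N) (hx : Irrational x) (hx01 : x ∈ Ioo (0 : ℝ) 1)
    (n : ℕ) {s t : ℝ} (hs : 0 ≤ s) (ht : 0 ≤ t) :
    |gaussBranch N x n s - gaussBranch N x n t| = N ^ n * |s - t| /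
      ((gaussB N x (n + 1) + s * gaussB N x n) * (gaussB N x (n + 1) + t * gaussB N x n)) := by
  induction n generalizing s t with
  | zero => simp [gaussBranch, gaussB]
  | succ n ih =>
    have hN0 : (0 : ℝ) < N := by exact_mod_cast hN
    have ha := hN0.trans_le (le_gaussDigit hN hx hx01 n)
    obtain ⟨h0, h1, h2⟩ := gaussB_bounds hN hx hx01 n
    have hs' : 0 < gaussDigit N x n + s := by linarith
    have ht' : 0 < gaussDigit N x n + t := by linarith
    have hsub : (N : ℝ) / (gaussDigit N x n + s) - N / (gaussDigit N x n + t) =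
        -(N / ((gaussDigit N x n + s) * (gaussDigit N x n + t)) * (s - t)) := by
      field_simp
      ring
    have hsub' : |(N : ℝ) / (gaussDigit N x n + s) - N / (gaussDigit N x n + t)| =
        N / ((gaussDigit N x n + s) * (gaussDigit N x n + t)) * |s - t| := by
      rw [hsub, abs_neg, abs_mul, abs_of_pos (by positivity)]
    have hden : ∀ {u : ℝ}, 0 < gaussDigit N x n + u →
        (gaussB N x (n + 1) : ℝ) + N / (gaussDigit N x n + u) * gaussB N x n =
          (gaussB N x (n + 1 + 1) + u * gaussB N x (n + 1)) / (gaussDigit N x n + u) := by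
      intro u hu
      rw [gaussB_add_two_cast]
      field_simp
      ring
    have hB := (gaussB_bounds hN hx hx01 (n + 1)).2.1
    simp only [gaussBranch]
    rw [ih (by positivity) (by positivity), hsub', hden hs', hden ht', pow_succ]
    have h3 : (0 : ℝ) < gaussB N x (n + 1 + 1) + s * gaussB N x (n + 1) := by positivity
    have h4 : (0 : ℝ) < gaussB N x (n + 1 + 1) + t * gaussB N x (n + 1) := by positivity
    field_simp

end Digits

section Ergodicity

variable {N : ℕ} {x : ℝ}

/-- Bounded distortion: a `T_N`-invariant set occupies a definite proportion of the neighbourhood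
of `x` at the scale of the rank-`n` cylinder containing `x`. -/
lemma volume_mul_closedBall_le (hN : 0 < N) (hx : Irrational x) (hx01 : x ∈ Ioo (0 : ℝ) 1)
    {S : Set ℝ} (hS : gaussT N ⁻¹' S = S) (n : ℕ) :
    volume (S ∩ Ioo 0 1) *
        volume (Metric.closedBall x ((N : ℝ) ^ n / (gaussB N x (n + 1) : ℝ) ^ 2)) ≤
      8 * volume (S ∩ Metric.closedBall x ((N : ℝ) ^ n / (gaussB N x (n + 1) : ℝ) ^ 2)) := by
  set b : ℝ := (gaussB N x (n + 1) : ℝ) with hb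
  set c : ℝ := (gaussB N x n : ℝ) with hc
  set δ : ℝ := (N : ℝ) ^ n / b ^ 2 with hδ
  have hN0 : (0 : ℝ) < N := by exact_mod_cast hN
  obtain ⟨hc0, hb1, hcb⟩ := gaussB_bounds hN hx hx01 n
  rw [← hc] at hc0 hcb
  rw [← hb] at hb1 hcb
  have hb0 : 0 < b := by linarith
  have hδ0 : 0 < δ := by positivity
  set φ := gaussBranch N x n with hφ
  have hsub : φ '' (S ∩ Ioo 0 1) ⊆ S ∩ Metric.closedBall x δ := by
    rintro _ ⟨t, ⟨htS, ht⟩, rfl⟩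
    constructor
    · have hSn : (gaussT N)^[n] ⁻¹' S = S := by
        have h := Function.iterate_fixed (f := preimage (gaussT N)) hS n
        rwa [← Set.preimage_iterate_eq] at h
      rw [← hSn, mem_preimage, hφ, iterate_gaussT_gaussBranch hN hx hx01 n ht]
      exact htS
    · obtain ⟨hu0, hu1⟩ := iterate_gaussT_mem_Ioo hN hx hx01 n
      have hφx : φ t - x = φ t - φ ((gaussT N)^[n] x) := by
        rw [hφ, gaussBranch_iterate_gaussT hN hx n]
      rw [Metric.mem_closedBall, Real.dist_eq, hφx, hφ,
        abs_gaussBranch_sub hN hx hx01 n ht.1.le hu0.le, hδ, ← hb, ← hc]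
      have h1 : |t - (gaussT N)^[n] x| ≤ 1 := by
        rw [abs_le]
        constructor <;> linarith [ht.1, ht.2]
      have h2 : b ^ 2 ≤ (b + t * c) * (b + (gaussT N)^[n] x * c) := by
        rw [sq]
        have := mul_nonneg ht.1.le hc0
        have := mul_nonneg hu0.le hc0
        gcongr <;> linarith
      gcongr
      exact mul_le_of_le_one_right (by positivity) h1
  have himg : (gaussT N)^[n] '' (φ '' (S ∩ Ioo 0 1)) = S ∩ Ioo 0 1 := by
    rw [image_image]
    conv_rhs => rw [← image_id (S ∩ Ioo 0 1)]
    exact image_congr fun t ht => iterate_gaussT_gaussBranch hN hx hx01 n ht.2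
  have hlip : LipschitzOnWith (Real.toNNReal (4 / δ)) (gaussT N)^[n] (φ '' (S ∩ Ioo 0 1)) := by
    refine LipschitzOnWith.of_dist_le_mul ?_
    rintro _ ⟨s, ⟨-, hs⟩, rfl⟩ _ ⟨t, ⟨-, ht⟩, rfl⟩
    rw [hφ, iterate_gaussT_gaussBranch hN hx hx01 n hs, iterate_gaussT_gaussBranch hN hx hx01 n ht,
      Real.coe_toNNReal _ (by positivity), Real.dist_eq, Real.dist_eq,
      abs_gaussBranch_sub hN hx hx01 n hs.1.le ht.1.le, ← hb, ← hc]
    have h2 : (b + s * c) * (b + t * c) ≤ 4 * b ^ 2 := by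
      have h3 : b + s * c ≤ 2 * b := by nlinarith [hs.2]
      have h4 : b + t * c ≤ 2 * b := by nlinarith [ht.2]
      have := mul_nonneg ht.1.le hc0
      calc (b + s * c) * (b + t * c) ≤ (2 * b) * (2 * b) := by gcongr
        _ = 4 * b ^ 2 := by ring
    have h5 : 0 < (b + s * c) * (b + t * c) := by
      have := mul_nonneg ht.1.le hc0
      have := mul_nonneg hs.1.le hc0
      positivity
    calc |s - t| = 4 / δ * ((N : ℝ) ^ n * |s - t| / (4 * b ^ 2)) := by
          rw [hδ]
          field_simp
      _ ≤ _ := by gcongr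
  have hvol : volume (S ∩ Ioo 0 1) ≤
      ENNReal.ofReal (4 / δ) * volume (S ∩ Metric.closedBall x δ) := by
    have h := hlip.hausdorffMeasure_image_le (d := 1) zero_le_one
    rw [himg, hausdorffMeasure_real, ENNReal.rpow_one] at h
    exact h.trans (by gcongr; rfl)
  calc volume (S ∩ Ioo 0 1) * volume (Metric.closedBall x δ)
      ≤ ENNReal.ofReal (4 / δ) * volume (S ∩ Metric.closedBall x δ) * ENNReal.ofReal (2 * δ) := by
        rw [Real.volume_closedBall]
        gcongr
    _ = ENNReal.ofReal (4 / δ * (2 * δ)) * volume (S ∩ Metric.closedBall x δ) := by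
        rw [mul_right_comm, ← ENNReal.ofReal_mul (by positivity)]
    _ = 8 * volume (S ∩ Metric.closedBall x δ) := by
        congr 1
        rw [show 4 / δ * (2 * δ) = 8 by field_simp; norm_num]
        simp

lemma ae_irrational : ∀ᵐ x : ℝ, Irrational x :=
  (countable_range ((↑) : ℚ → ℝ)).ae_notMem volume

/-- A `T_N`-invariant set is null or conull in `(0, 1)`. -/
lemma volume_inter_Ioo_eq_zero_or (hN : 0 < N) {S : Set ℝ} (hSm : MeasurableSet S)
    (hS : gaussT N ⁻¹' S = S) :
    volume (S ∩ Ioo 0 1) = 0 ∨ volume (Sᶜ ∩ Ioo 0 1) = 0 := by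
  by_contra! h
  obtain ⟨h1, h2⟩ := h
  refine h1 ?_
  rw [inter_comm, ← Measure.restrict_apply' hSm]
  have hdens := IsUnifLocDoublingMeasure.ae_tendsto_measure_inter_div volume S 1
  rw [← compl_compl (Ioo (0 : ℝ) 1), ← mem_ae_iff]
  filter_upwards [hdens, ae_restrict_of_ae ae_irrational] with x hx hirr hx01
  have hScompl : gaussT N ⁻¹' Sᶜ = Sᶜ := by rw [preimage_compl, hS]
  have hδpos : ∀ n, 0 < (N : ℝ) ^ n / (gaussB N x (n + 1) : ℝ) ^ 2 := fun n => by
    have hN0 : (0 : ℝ) < N := by exact_mod_cast hN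
    have := (gaussB_bounds hN hirr hx01 n).2.1
    positivity
  have hlim := hx (l := atTop) (fun _ : ℕ => x)
    (fun n => (N : ℝ) ^ n / (gaussB N x (n + 1) : ℝ) ^ 2)
    (tendsto_nhdsWithin_iff.2 ⟨tendsto_pow_div_gaussB_sq hN hirr hx01,
      Eventually.of_forall hδpos⟩)
    (Eventually.of_forall fun n => by
      rw [one_mul]; exact Metric.mem_closedBall_self (hδpos n).le)
  have hlim' := hlim.add_const (volume (Sᶜ ∩ Ioo 0 1) / 8)
  have hle : 1 + volume (Sᶜ ∩ Ioo 0 1) / 8 ≤ 1 := by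
    refine le_of_tendsto' hlim' fun n => ?_
    have hdist := volume_mul_closedBall_le hN hirr hx01 hScompl n
    set I := Metric.closedBall x ((N : ℝ) ^ n / (gaussB N x (n + 1) : ℝ) ^ 2) with hI
    have hI0 : volume I ≠ 0 := by
      rw [hI, Real.volume_closedBall]
      simpa using hδpos n
    have hItop : volume I ≠ ⊤ := by
      rw [hI, Real.volume_closedBall]
      exact ENNReal.ofReal_ne_top
    have h8 : volume (Sᶜ ∩ Ioo 0 1) / 8 ≤ volume (Sᶜ ∩ I) / volume I := by
      rw [ENNReal.le_div_iff_mul_le (Or.inl hI0) (Or.inl hItop), ← ENNReal.mul_div_right_comm]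
      exact ENNReal.div_le_of_le_mul' hdist
    calc volume (S ∩ I) / volume I + volume (Sᶜ ∩ Ioo 0 1) / 8
        ≤ volume (S ∩ I) / volume I + volume (Sᶜ ∩ I) / volume I := by gcongr
      _ = volume I / volume I := by
        rw [← ENNReal.add_div, inter_comm S, inter_comm Sᶜ, ← sdiff_eq,
          measure_inter_add_sdiff I hSm]
      _ = 1 := ENNReal.div_self hI0 hItop
  have hz : volume (Sᶜ ∩ Ioo 0 1) / 8 = 0 := by
    by_contra hne
    exact absurd hle (not_le.2 (ENNReal.lt_add_right ENNReal.one_ne_top hne))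
  rw [ENNReal.div_eq_zero_iff] at hz
  exact hz.elim h2 (by simp)

end Ergodicity

section GaussMeasure

variable {N : ℕ}

/-- The (unnormalized) absolutely continuous `T_N`-invariant measure on `(0, 1)`, with density
`1 / (N + x)`. -/
noncomputable def gaussMeasure (N : ℕ) : Measure ℝ :=
  (volume.restrict (Ioo 0 1)).withDensity fun x => ENNReal.ofReal ((N + x)⁻¹)

lemma ae_gaussMeasure_mem_Ioo : ∀ᵐ x ∂gaussMeasure N, x ∈ Ioo (0 : ℝ) 1 :=
  (withDensity_absolutelyContinuous _ _).ae_le (ae_restrict_mem measurableSet_Ioo)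

lemma ae_gaussMeasure_irrational : ∀ᵐ x ∂gaussMeasure N, Irrational x :=
  (withDensity_absolutelyContinuous _ _).ae_le (ae_restrict_of_ae ae_irrational)

lemma volume_restrict_Ioo_absolutelyContinuous (N : ℕ) :
    volume.restrict (Ioo (0 : ℝ) 1) ≪ gaussMeasure N := by
  refine withDensity_absolutelyContinuous' (by fun_prop) ?_
  filter_upwards [ae_restrict_mem measurableSet_Ioo] with x hx
  have : 0 < (N : ℝ) + x := add_pos_of_nonneg_of_pos (Nat.cast_nonneg N) hx.1
  simpa using this

lemma gaussMeasure_Icc (hN : 0 < N) {a b : ℝ} (ha : 0 ≤ a) (hab : a ≤ b) (hb : b ≤ 1) :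
    gaussMeasure N (Icc a b) = ENNReal.ofReal (Real.log (N + b) - Real.log (N + a)) := by
  have hN0 : (0 : ℝ) < N := by exact_mod_cast hN
  have hpos : ∀ x ∈ Icc a b, (N : ℝ) + x ≠ 0 := fun x hx => by linarith [hx.1]
  rw [gaussMeasure, withDensity_apply _ measurableSet_Icc, Measure.restrict_congr_set Ioo_ae_eq_Icc,
    Measure.restrict_restrict measurableSet_Icc, inter_eq_left.2 (Icc_subset_Icc ha hb)]
  have hcont : ContinuousOn (fun x : ℝ => ((N : ℝ) + x)⁻¹) (Icc a b) :=
    (by fun_prop : ContinuousOn (fun x : ℝ => (N : ℝ) + x) (Icc a b)).inv₀ hpos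
  rw [← ofReal_integral_eq_lintegral_ofReal hcont.integrableOn_Icc
    ((ae_restrict_mem measurableSet_Icc).mono fun x hx => inv_nonneg.2 (by linarith [hx.1])),
    integral_Icc_eq_integral_Ioc, ← intervalIntegral.integral_of_le hab]
  congr 1
  rw [← uIcc_of_le hab] at hpos hcont
  refine intervalIntegral.integral_eq_sub_of_hasDerivAt (f := fun x => Real.log (N + x))
    (fun x hx => ?_) hcont.intervalIntegrable
  simpa using ((hasDerivAt_id x).const_add (N : ℝ)).log (hpos x hx)

lemma gaussMeasure_univ (hN : 0 < N) :
    gaussMeasure N univ = ENNReal.ofReal (Real.log (N + 1) - Real.log N) := by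
  have h : (univ : Set ℝ) =ᵐ[gaussMeasure N] Icc 0 1 := by
    filter_upwards [ae_gaussMeasure_mem_Ioo] with x hx
    exact propext ⟨fun _ => Ioo_subset_Icc_self hx, fun _ => trivial⟩
  rw [measure_congr h, gaussMeasure_Icc hN le_rfl zero_le_one le_rfl, add_zero]

lemma isFiniteMeasure_gaussMeasure (hN : 0 < N) : IsFiniteMeasure (gaussMeasure N) :=
  ⟨by rw [gaussMeasure_univ hN]; exact ENNReal.ofReal_lt_top⟩

lemma natCast_div_add_add_le (hN : 0 < N) {t : ℝ} (ht : 0 ≤ t) (k : ℕ) :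
    (N : ℝ) / (N + k + t) ≤ N / (N + k) := by
  have hN0 : (0 : ℝ) < N := by exact_mod_cast hN
  exact div_le_div_of_nonneg_left hN0.le (by positivity) (by linarith)

lemma hasSum_log_sub_log (hN : 0 < N) {t : ℝ} (ht : 0 ≤ t) :
    HasSum (fun k : ℕ => Real.log (N + N / (N + k)) - Real.log (N + N / (N + k + t)))
      (Real.log (N + t) - Real.log N) := by
  have hN0 : (0 : ℝ) < N := by exact_mod_cast hN
  rw [hasSum_iff_tendsto_nat_of_nonneg]
  · set u : ℕ → ℝ := fun k => Real.log (N + k + t) - Real.log (N + k) with hu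
    have hterm : ∀ k : ℕ, Real.log (N + N / (N + k)) - Real.log (N + N / (N + k + t)) =
        u k - u (k + 1) := by
      intro k
      have h1 : (N : ℝ) + N / (N + k) = N * (N + (k + 1 : ℕ)) / (N + k) := by
        push_cast
        field_simp
        ring
      have h2 : (N : ℝ) + N / (N + k + t) = N * (N + (k + 1 : ℕ) + t) / (N + k + t) := by
        push_cast
        field_simp
        ring
      rw [h1, h2, Real.log_div (by positivity) (by positivity),
        Real.log_div (by positivity) (by positivity), Real.log_mul (by positivity) (by positivity),
        Real.log_mul (by positivity) (by positivity)]
      simp only [hu]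
      ring
    have hlim : Tendsto u atTop (nhds 0) := by
      have h1 : Tendsto (fun k : ℕ => Real.log (1 + t / (N + k))) atTop (nhds (Real.log (1 + 0))) := by
        refine Tendsto.log (tendsto_const_nhds.add ?_) (by norm_num)
        exact tendsto_const_nhds.div_atTop
          (tendsto_atTop_add_const_left _ _ tendsto_natCast_atTop_atTop)
      rw [add_zero, Real.log_one] at h1
      refine h1.congr fun k => ?_
      simp only [hu]
      rw [← Real.log_div (by positivity) (by positivity)]
      congr 1
      field_simp
    have := hlim.const_sub (u 0)
    simp only [hterm, Finset.sum_range_sub']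
    simpa [hu] using this
  · intro k
    rw [sub_nonneg]
    exact Real.log_le_log (by positivity) (by linarith [natCast_div_add_add_le hN ht k])

lemma floor_eq_and_fract_le_iff (hN : 0 < N) {x t : ℝ} (hx : 0 < x) (ht : 0 ≤ t) (ht1 : t < 1)
    (k : ℕ) : x ∈ Icc ((N : ℝ) / (N + k + t)) (N / (N + k)) ↔
      ⌊(N : ℝ) / x⌋ = (N + k : ℤ) ∧ Int.fract ((N : ℝ) / x) ≤ t := by
  have hN0 : (0 : ℝ) < N := by exact_mod_cast hN
  rw [mem_Icc, div_le_comm₀ (by positivity) hx, le_div_comm₀ hx (by positivity)]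
  constructor
  · rintro ⟨h1, h2⟩
    have hfl : ⌊(N : ℝ) / x⌋ = (N + k : ℤ) := by
      rw [Int.floor_eq_iff]
      push_cast
      constructor <;> linarith
    refine ⟨hfl, ?_⟩
    rw [Int.fract, hfl]
    push_cast
    linarith
  · rintro ⟨h1, h2⟩
    have h3 := Int.floor_le ((N : ℝ) / x)
    rw [Int.fract, h1] at h2
    rw [h1] at h3
    push_cast at h2 h3
    constructor <;> linarith

lemma measurePreserving_gaussT (hN : 0 < N) :
    MeasurePreserving (gaussT N) (gaussMeasure N) (gaussMeasure N) := by
  have hN0 : (0 : ℝ) < N := by exact_mod_cast hN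
  have hfin := isFiniteMeasure_gaussMeasure hN
  refine ⟨measurable_gaussT N, (Measure.ext_of_Iic _ _ fun t => ?_).symm⟩
  rw [Measure.map_apply (measurable_gaussT N) measurableSet_Iic]
  have hT : ∀ᵐ x ∂gaussMeasure N, gaussT N x ∈ Ioo (0 : ℝ) 1 :=
    ae_gaussMeasure_irrational.mono fun x hx => gaussT_mem_Ioo hN hx
  rcases lt_or_ge t 0 with ht | ht
  · rw [measure_eq_zero_iff_ae_notMem.2, measure_eq_zero_iff_ae_notMem.2]
    · filter_upwards [hT] with x hx hxt
      exact absurd (hx.1.trans_le hxt) (not_lt.2 ht.le)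
    · filter_upwards [ae_gaussMeasure_mem_Ioo] with x hx hxt
      exact absurd (hx.1.trans_le hxt) (not_lt.2 ht.le)
  rcases le_or_gt 1 t with ht1 | ht1
  · refine measure_congr ?_
    filter_upwards [hT, ae_gaussMeasure_mem_Ioo] with x hx hx'
    exact propext ⟨fun _ => hx.2.le.trans ht1, fun _ => hx'.2.le.trans ht1⟩
  have h1 : Iic t =ᵐ[gaussMeasure N] Icc 0 t := by
    filter_upwards [ae_gaussMeasure_mem_Ioo] with x hx
    exact propext ⟨fun h => ⟨hx.1.le, h⟩, fun h => h.2⟩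
  have h2 : gaussT N ⁻¹' Iic t =ᵐ[gaussMeasure N]
      ⋃ k : ℕ, Icc ((N : ℝ) / (N + k + t)) (N / (N + k)) := by
    filter_upwards [ae_gaussMeasure_mem_Ioo] with x hx
    refine propext ?_
    change gaussT N x ≤ t ↔ x ∈ ⋃ k : ℕ, Icc ((N : ℝ) / (N + k + t)) (N / (N + k))
    rw [gaussT_of_ne_zero hx.1.ne', mem_iUnion]
    simp only [floor_eq_and_fract_le_iff hN hx.1 ht ht1]
    refine ⟨fun h => ?_, fun ⟨_, _, h⟩ => h⟩
    have hle : (N : ℤ) ≤ ⌊(N : ℝ) / x⌋ := by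
      rw [Int.le_floor, Int.cast_natCast]
      exact le_div_self hN0.le hx.1 hx.2.le
    obtain ⟨k, hk⟩ := Int.le.dest hle
    exact ⟨k, hk.symm, h⟩
  rw [measure_congr h1, measure_congr h2, gaussMeasure_Icc hN le_rfl ht ht1.le, measure_iUnion]
  · have hk : ∀ k : ℕ, gaussMeasure N (Icc ((N : ℝ) / (N + k + t)) (N / (N + k))) =
        ENNReal.ofReal (Real.log (N + N / (N + k)) - Real.log (N + N / (N + k + t))) := by
      intro k
      refine gaussMeasure_Icc hN (by positivity) (natCast_div_add_add_le hN ht k) ?_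
      rw [div_le_one (by positivity)]
      simp
    have hsum := hasSum_log_sub_log hN ht
    simp only [hk]
    rw [add_zero, ← hsum.tsum_eq, ENNReal.ofReal_tsum_of_nonneg (fun k => ?_) hsum.summable]
    rw [sub_nonneg]
    exact Real.log_le_log (by positivity) (by linarith [natCast_div_add_add_le hN ht k])
  · intro i j hij
    refine disjoint_left.2 fun x hi hj => hij ?_
    have hx : 0 < x := lt_of_lt_of_le (by positivity) hi.1
    rw [floor_eq_and_fract_le_iff hN hx ht ht1] at hi hj
    have := hi.1.symm.trans hj.1
    omega
  · exact fun _ => measurableSet_Icc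

theorem ergodic_gaussT (hN : 0 < N) : Ergodic (gaussT N) (gaussMeasure N) := by
  refine ⟨measurePreserving_gaussT hN, ⟨fun S hSm hS => ?_⟩⟩
  have hac : gaussMeasure N ≪ volume.restrict (Ioo 0 1) := withDensity_absolutelyContinuous _ _
  rw [eventuallyConst_set']
  rcases volume_inter_Ioo_eq_zero_or hN hSm hS with h | h
  · rw [← Measure.restrict_apply hSm] at h
    exact Or.inl (ae_eq_empty.2 (hac h))
  · rw [← Measure.restrict_apply hSm.compl] at h
    exact Or.inr (ae_eq_univ.2 (hac h))

lemma intervalIntegrable_log_one_add_div (hN : 0 < N) :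
    IntervalIntegrable (fun x : ℝ => Real.log (1 + x / N) / x) volume 0 1 := by
  have hN0 : (0 : ℝ) < N := by exact_mod_cast hN
  rw [intervalIntegrable_iff_integrableOn_Ioc_of_le zero_le_one]
  refine Measure.integrableOn_of_bounded (M := 1 / N) (by simp) ?_ ?_
  · exact (by fun_prop : Measurable fun x : ℝ => Real.log (1 + x / N) / x).aestronglyMeasurable
  filter_upwards [ae_restrict_mem measurableSet_Ioc] with x hx
  have hx0 := hx.1
  rw [Real.norm_of_nonneg (div_nonneg (Real.log_nonneg (by simp; positivity)) hx.1.le),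
    div_le_iff₀ hx0]
  have := Real.log_le_sub_one_of_pos (show 0 < 1 + x / N by positivity)
  calc Real.log (1 + x / N) ≤ x / N := by linarith
    _ = 1 / N * x := by ring

lemma intervalIntegrable_log_mul_inv (hN : 0 < N) :
    IntervalIntegrable (fun x : ℝ => Real.log x * (N + x)⁻¹) volume 0 1 := by
  have hN0 : (0 : ℝ) < N := by exact_mod_cast hN
  refine intervalIntegral.intervalIntegrable_log'.mul_continuousOn ?_
  refine ContinuousOn.inv₀ (by fun_prop) fun x hx => ?_
  rw [uIcc_of_le zero_le_one] at hx
  linarith [hx.1]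

lemma dilogTheta_one_div (hN : 0 < N) :
    dilogTheta (1 / N) = ∫ x in (0 : ℝ)..1, Real.log (1 + x / N) / x := by
  have hN0 : (N : ℝ) ≠ 0 := by exact_mod_cast hN.ne'
  have h := intervalIntegral.integral_comp_div (a := 0) (b := 1)
    (fun t : ℝ => Real.log (1 + t) / t) hN0
  rw [zero_div, smul_eq_mul] at h
  rw [dilogTheta, ← mul_right_inj' hN0, ← h, ← intervalIntegral.integral_const_mul]
  congr 1
  ext x
  rw [div_div_eq_mul_div]
  ring

lemma intervalIntegral_log_mul_inv (hN : 0 < N) :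
    ∫ x in (0 : ℝ)..1, Real.log x * (N + x)⁻¹ = -dilogTheta (1 / N) := by
  have hN0 : (0 : ℝ) < N := by exact_mod_cast hN
  have hi1 := intervalIntegrable_log_one_add_div hN
  have hi2 := intervalIntegrable_log_mul_inv hN
  have h0 : Tendsto (fun x : ℝ => Real.log x * Real.log (1 + x / N)) (nhdsWithin 0 (Ioi 0))
      (nhds 0) := by
    have hlim : Tendsto (fun x : ℝ => |x * Real.log x| * (1 / N)) (nhdsWithin 0 (Ioi 0))
        (nhds 0) := by
      have hc : Continuous fun x : ℝ => |x * Real.log x| * (1 / N) :=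
        Real.continuous_mul_log.abs.mul continuous_const
      simpa using (hc.tendsto 0).mono_left nhdsWithin_le_nhds
    refine squeeze_zero_norm' ?_ hlim
    filter_upwards [self_mem_nhdsWithin] with x (hx : 0 < x)
    have hl := Real.log_le_sub_one_of_pos (show 0 < 1 + x / N by positivity)
    have hl0 : 0 ≤ Real.log (1 + x / N) := Real.log_nonneg (by simp; positivity)
    rw [norm_mul, Real.norm_eq_abs, Real.norm_of_nonneg hl0, abs_mul, abs_of_pos hx]
    calc |Real.log x| * Real.log (1 + x / N) ≤ |Real.log x| * (x / N) := by
          gcongr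
          linarith
      _ = x * |Real.log x| * (1 / N) := by ring
  have h1 : Tendsto (fun x : ℝ => Real.log x * Real.log (1 + x / N)) (nhdsWithin 1 (Iio 1))
      (nhds 0) := by
    have hc : ContinuousAt (fun x : ℝ => Real.log x * Real.log (1 + x / N)) 1 := by
      refine (Real.continuousAt_log one_ne_zero).mul (ContinuousAt.log (by fun_prop) ?_)
      positivity
    simpa using hc.tendsto.mono_left nhdsWithin_le_nhds
  have hFTC := intervalIntegral.integral_eq_sub_of_hasDerivAt_of_tendsto zero_lt_one
    (f' := fun x : ℝ => Real.log (1 + x / N) / x + Real.log x * (N + x)⁻¹)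
    (fun x hx => ?_) (hi1.add hi2) h0 h1
  · rw [intervalIntegral.integral_add hi1 hi2, ← dilogTheta_one_div hN] at hFTC
    linarith
  · have hx0 := hx.1
    have hd := ((((hasDerivAt_id x).div_const (N : ℝ)).const_add 1).log
      (show (1 + id x / N : ℝ) ≠ 0 by simp only [id]; positivity))
    refine ((Real.hasDerivAt_log hx0.ne').mul hd).congr_deriv ?_
    simp only [id]
    field_simp

lemma integrable_log_gaussMeasure (hN : 0 < N) : Integrable Real.log (gaussMeasure N) := by
  rw [gaussMeasure, integrable_withDensity_iff (by fun_prop) (by simp)]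
  have h := (intervalIntegrable_iff_integrableOn_Ioo_of_le zero_le_one).1
    (intervalIntegrable_log_mul_inv hN)
  refine h.congr ?_
  filter_upwards [ae_restrict_mem measurableSet_Ioo] with x hx
  rw [ENNReal.toReal_ofReal (inv_nonneg.2 (add_nonneg (Nat.cast_nonneg N) hx.1.le))]

lemma integral_log_gaussMeasure (hN : 0 < N) :
    ∫ x, Real.log x ∂gaussMeasure N = -dilogTheta (1 / N) := by
  rw [← intervalIntegral_log_mul_inv hN, gaussMeasure,
    integral_withDensity_eq_integral_toReal_smul (by fun_prop) (by simp),
    intervalIntegral.integral_of_le zero_le_one, integral_Ioc_eq_integral_Ioo]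
  refine setIntegral_congr_fun measurableSet_Ioo fun x hx => ?_
  simp only [smul_eq_mul]
  rw [ENNReal.toReal_ofReal (inv_nonneg.2 (add_nonneg (Nat.cast_nonneg N) hx.1.le)), mul_comm]

lemma average_log_sub_log_gaussMeasure (hN : 0 < N) :
    ⨍ x, (Real.log N - Real.log x) ∂gaussMeasure N = gaussLambda N + Real.log N := by
  have hfin := isFiniteMeasure_gaussMeasure hN
  have hN0 : (0 : ℝ) < N := by exact_mod_cast hN
  have hlt : Real.log N < Real.log (N + 1) := Real.log_lt_log hN0 (by linarith)
  have hμ : (gaussMeasure N).real univ = Real.log (1 + 1 / N) := by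
    rw [Measure.real, gaussMeasure_univ hN, ENNReal.toReal_ofReal (by linarith),
      ← Real.log_div (by positivity) hN0.ne']
    congr 1
    field_simp
  have hpos : 0 < Real.log (1 + 1 / N) := Real.log_pos (by simp; positivity)
  rw [average_eq, integral_sub (integrable_const _) (integrable_log_gaussMeasure hN),
    integral_log_gaussMeasure hN, integral_const, hμ, gaussLambda, smul_eq_mul, smul_eq_mul]
  generalize Real.log (1 + 1 / (N : ℝ)) = L at hpos ⊢
  field_simp
  ring

end GaussMeasure

/-- Generalized Lévy constant: for Lebesgue almost every `x ∈ [0,1)`,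
`(log B_n)/n → Λ_N + log N`. -/
theorem gaussT_levy (N : ℕ) (hN : 0 < N) :
    ∀ᵐ x ∂(volume.restrict (Set.Ico (0:ℝ) 1)),
      Tendsto (fun n : ℕ => Real.log ((gaussB N x (n + 1) : ℝ)) / n)
        atTop (nhds (gaussLambda N + Real.log N)) := by
  have hfin := isFiniteMeasure_gaussMeasure hN
  rw [← Measure.restrict_congr_set Ioo_ae_eq_Ico]
  refine (volume_restrict_Ioo_absolutelyContinuous N).ae_le ?_
  have hbirk := (ergodic_gaussT hN).ae_tendsto_birkhoffAverage
    (f := fun y => Real.log N - Real.log y) (measurable_const.sub Real.measurable_log)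
    ((integrable_const _).sub (integrable_log_gaussMeasure hN))
  filter_upwards [hbirk, ae_gaussMeasure_mem_Ioo, ae_gaussMeasure_irrational] with x hx hx01 hirr
  rw [average_log_sub_log_gaussMeasure hN] at hx
  have herr : Tendsto (fun n : ℕ => (Real.log (gaussB N x (n + 1)) -
      birkhoffSum (gaussT N) (fun y => Real.log N - Real.log y) n x) / n) atTop (nhds 0) := by
    refine squeeze_zero_norm (fun n => ?_) (tendsto_const_div_atTop_nhds_zero_nat (Real.log 2))
    rw [norm_div, Real.norm_eq_abs, Real.norm_natCast]
    gcongr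
    exact abs_log_gaussB_sub_birkhoffSum_le hN hirr hx01 n
  refine (zero_add (gaussLambda N + Real.log N) ▸ herr.add hx).congr fun n => ?_
  rw [birkhoffAverage, smul_eq_mul]
  ring
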